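/- For all x, y ∈ X and all t ≥ 0: if C(x) = C(y) = c then E_t(|x⟩⟨y| ⊗ |1⟩⟨1|) = |x⟩⟨y| ⊗ (e^{−γt}|1⟩⟨1| + (1 − e^{−γt})|c⟩⟨c|), while if C(x) ≠ C(y) then E_t(|x⟩⟨y| ⊗ |1⟩⟨1|) = e^{−γt/2} · |x⟩⟨y| ⊗ |1⟩⟨1|. -/

import Mathlib

open Matrix Filter
open scoped Kronecker Topology

attribute [local instance] Matrix.normedAddCommGroup Matrix.normedSpace

noncomputable section

/-- The computational basis of `n` qubits, `X = {0,1}ⁿ`. -/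
abbrev QubitBasis (n : ℕ) := Fin n → Bool

/-- Evaluation of the 3-literal clause with indices `i₁ i₂ i₃` and bits `b₁ b₂ b₃`:
`C(x) = ¬(x i₁ = b₁ ∧ x i₂ = b₂ ∧ x i₃ = b₃)`. -/
def clauseEval {n : ℕ} (i₁ i₂ i₃ : Fin n) (b₁ b₂ b₃ : Bool) (x : QubitBasis n) : Bool :=
  ! (decide (x i₁ = b₁) && decide (x i₂ = b₂) && decide (x i₃ = b₃))

/-- The Lindblad operator `L = Π⁻ ⊗ σ⁻` attached to a clause `C`:
`L((x,a),(y,b)) = 1` iff `x = y`, `C(x) = false`, `a = false`, `b = true`. -/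
def jumpOp {n : ℕ} (C : QubitBasis n → Bool) :
    Matrix (QubitBasis n × Bool) (QubitBasis n × Bool) ℂ :=
  Matrix.of fun p q =>
    if p.1 = q.1 ∧ C p.1 = false ∧ p.2 = false ∧ q.2 = true then 1 else 0

/-- The Lindbladian `ℒ(ρ) = γ (L ρ L† − (1/2)(L†L ρ + ρ L†L))` as a linear endomorphism
of the matrix space. -/
def lindbladian {d : Type*} [Fintype d] [DecidableEq d] (γ : ℝ) (L : Matrix d d ℂ) :
    Matrix d d ℂ →ₗ[ℂ] Matrix d d ℂ :=
  (γ : ℂ) • ((LinearMap.mulRight ℂ Lᴴ).comp (LinearMap.mulLeft ℂ L)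
    - (1 / 2 : ℂ) • (LinearMap.mulLeft ℂ (Lᴴ * L) + LinearMap.mulRight ℂ (Lᴴ * L)))

/-- The evolution `E_t = exp(t·ℒ)`, the exponential of the endomorphism `ℒ`. -/
def evol {d : Type*} [Fintype d] [DecidableEq d]
    (L : Matrix d d ℂ →ₗ[ℂ] Matrix d d ℂ) (t : ℝ) :
    Matrix d d ℂ →L[ℂ] Matrix d d ℂ :=
  haveI : IsTopologicalRing (Matrix d d ℂ →L[ℂ] Matrix d d ℂ) :=
    @NonUnitalSeminormedRing.toIsTopologicalRing _ (ContinuousLinearMap.toNormedRing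
      (𝕜 := ℂ) (E := Matrix d d ℂ)).toNonUnitalNormedRing.toNonUnitalSeminormedRing
  NormedSpace.exp ((t : ℂ) • LinearMap.toContinuousLinearMap L)

/-- The exponential of an operator acts on an eigenvector as the scalar exponential. -/
theorem exp_apply_eigenvector {E : Type*} [NormedAddCommGroup E] [NormedSpace ℂ E]
    [CompleteSpace E] (A : E →L[ℂ] E) (v : E) (l : ℂ) (h : A v = l • v) :
    NormedSpace.exp A v = Complex.exp l • v := by
  have hpow : ∀ k : ℕ, (A ^ k) v = l ^ k • v := by
    intro k
    induction k with
    | zero => simp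
    | succ k ih => rw [pow_succ, mul_apply_eq_comp, h, map_smul, ih, smul_smul,
        pow_succ, mul_comm]
  have h1 := (NormedSpace.exp_series_hasSum_exp' (𝕂 := ℂ) A).mapL
    (ContinuousLinearMap.apply ℂ E v)
  have h2 := (NormedSpace.exp_series_hasSum_exp' (𝕂 := ℂ) l).smul_const v
  rw [← Complex.exp_eq_exp_ℂ] at h2
  refine HasSum.unique h1 ?_
  convert h2 using 2 with k
  simp [hpow, smul_smul]

theorem evol_apply_eigenvector {d : Type*} [Fintype d] [DecidableEq d]
    (L : Matrix d d ℂ →ₗ[ℂ] Matrix d d ℂ) (t : ℝ) (v : Matrix d d ℂ) (l : ℂ)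
    (h : L v = l • v) : evol L t v = Complex.exp (t * l) • v := by
  unfold evol
  exact exp_apply_eigenvector ((t : ℂ) • LinearMap.toContinuousLinearMap L) v (t * l)
    (show (t : ℂ) • L v = ((t : ℂ) * l) • v by rw [h, smul_smul])

theorem jumpOp_mul_single {n : ℕ} (C : QubitBasis n → Bool) (x y : QubitBasis n) (a b : Bool) :
    jumpOp C * Matrix.single (x, a) (y, b) (1 : ℂ)
      = if C x = false ∧ a = true then Matrix.single (x, false) (y, b) 1 else 0 := by
  ext ⟨p, p'⟩ ⟨q, q'⟩
  simp only [Matrix.mul_apply, Matrix.single_apply, jumpOp, Matrix.of_apply, ite_and]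
  rw [Finset.sum_eq_single (x, a)]
  · split_ifs <;> simp_all [Matrix.single_apply] <;> (rintro rfl; simp_all)
  · intro k _ hk
    simp [Ne.symm hk]
  · simp

theorem jumpOpH_mul_single {n : ℕ} (C : QubitBasis n → Bool) (x y : QubitBasis n) (a b : Bool) :
    (jumpOp C)ᴴ * Matrix.single (x, a) (y, b) (1 : ℂ)
      = if C x = false ∧ a = false then Matrix.single (x, true) (y, b) 1 else 0 := by
  ext ⟨p, p'⟩ ⟨q, q'⟩
  simp only [Matrix.mul_apply, Matrix.single_apply, jumpOp, Matrix.of_apply, ite_and,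
    Matrix.conjTranspose_apply]
  rw [Finset.sum_eq_single (x, a)]
  · split_ifs <;> simp_all [Matrix.single_apply]
  · intro k _ hk
    simp [Ne.symm hk]
  · simp

theorem single_mul_jumpOpH {n : ℕ} (C : QubitBasis n → Bool) (x y : QubitBasis n) (a b : Bool) :
    Matrix.single (x, a) (y, b) (1 : ℂ) * (jumpOp C)ᴴ
      = if C y = false ∧ b = true then Matrix.single (x, a) (y, false) 1 else 0 := by
  have h := congrArg Matrix.conjTranspose (jumpOp_mul_single C y x b a)
  rw [Matrix.conjTranspose_mul, Matrix.conjTranspose_single] at h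
  rw [star_one] at h
  rw [h]
  split_ifs <;> simp [Matrix.conjTranspose_single]

theorem single_mul_jumpOp {n : ℕ} (C : QubitBasis n → Bool) (x y : QubitBasis n) (a b : Bool) :
    Matrix.single (x, a) (y, b) (1 : ℂ) * jumpOp C
      = if C y = false ∧ b = false then Matrix.single (x, a) (y, true) 1 else 0 := by
  have h := congrArg Matrix.conjTranspose (jumpOpH_mul_single C y x b a)
  rw [Matrix.conjTranspose_mul, Matrix.conjTranspose_single, Matrix.conjTranspose_conjTranspose]
    at h
  rw [star_one] at h
  rw [h]
  split_ifs <;> simp [Matrix.conjTranspose_single]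

theorem lindbladian_single_true {n : ℕ} (γ : ℝ) (C : QubitBasis n → Bool) (x y : QubitBasis n) :
    lindbladian γ (jumpOp C) (Matrix.single (x, true) (y, true) 1)
      = (γ : ℂ) • ((if C x = false ∧ C y = false then Matrix.single (x, false) (y, false) 1 else 0)
        - (1 / 2 : ℂ) • ((if C x = false then Matrix.single (x, true) (y, true) 1 else 0)
          + (if C y = false then Matrix.single (x, true) (y, true) 1 else 0))) := by
  simp only [lindbladian, LinearMap.smul_apply, LinearMap.sub_apply, LinearMap.add_apply,
    LinearMap.comp_apply, LinearMap.mulLeft_apply, LinearMap.mulRight_apply]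
  rw [Matrix.mul_assoc (jumpOp C)ᴴ, ← Matrix.mul_assoc _ (jumpOp C)ᴴ (jumpOp C), jumpOp_mul_single,
    single_mul_jumpOpH]
  cases hx : C x <;> cases hy : C y <;>
    simp [single_mul_jumpOpH, single_mul_jumpOp, jumpOpH_mul_single, hx, hy]

theorem lindbladian_single_false {n : ℕ} (γ : ℝ) (C : QubitBasis n → Bool) (x y : QubitBasis n) :
    lindbladian γ (jumpOp C) (Matrix.single (x, false) (y, false) 1) = 0 := by
  simp only [lindbladian, LinearMap.smul_apply, LinearMap.sub_apply, LinearMap.add_apply,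
    LinearMap.comp_apply, LinearMap.mulLeft_apply, LinearMap.mulRight_apply]
  rw [Matrix.mul_assoc (jumpOp C)ᴴ, ← Matrix.mul_assoc _ (jumpOp C)ᴴ (jumpOp C), jumpOp_mul_single,
    single_mul_jumpOpH]
  simp

/-- Proposition 1: finite-time evolution of the matrix element
`|x⟩⟨y| ⊗ |1⟩⟨1|` under the single-clause dissipative network. -/
theorem evol_matrix_unit {n : ℕ} (hn : 1 ≤ n)
    (i₁ i₂ i₃ : Fin n) (h₁₂ : i₁ ≠ i₂) (h₁₃ : i₁ ≠ i₃) (h₂₃ : i₂ ≠ i₃)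
    (b₁ b₂ b₃ : Bool) (γ : ℝ) (hγ : 0 < γ)
    (C : QubitBasis n → Bool) (hC : C = clauseEval i₁ i₂ i₃ b₁ b₂ b₃)
    (x y : QubitBasis n) (t : ℝ) (ht : 0 ≤ t) :
    (∀ c : Bool, C x = c → C y = c →
      evol (lindbladian γ (jumpOp C)) t (Matrix.single (x, true) (y, true) 1)
        = (Real.exp (-(γ * t)) : ℂ) • Matrix.single (x, true) (y, true) (1 : ℂ)
          + ((1 - Real.exp (-(γ * t)) : ℝ) : ℂ) • Matrix.single (x, c) (y, c) (1 : ℂ)) ∧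
    (C x ≠ C y →
      evol (lindbladian γ (jumpOp C)) t (Matrix.single (x, true) (y, true) 1)
        = (Real.exp (-(γ * t / 2)) : ℂ) • Matrix.single (x, true) (y, true) (1 : ℂ)) := by
  constructor
  · rintro c hx hy
    cases c with
    | true =>
      have h := evol_apply_eigenvector (lindbladian γ (jumpOp C)) t
        (Matrix.single (x, true) (y, true) 1) 0 (by rw [lindbladian_single_true]; simp [hx, hy])
      rw [h, ← add_smul]
      simp
    | false =>
      have h0 := evol_apply_eigenvector (lindbladian γ (jumpOp C)) t
        (Matrix.single (x, false) (y, false) 1) 0 (by rw [lindbladian_single_false]; simp)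
      have h1 := evol_apply_eigenvector (lindbladian γ (jumpOp C)) t
        (Matrix.single (x, true) (y, true) 1 - Matrix.single (x, false) (y, false) 1) (-γ) (by
          rw [map_sub, lindbladian_single_false, lindbladian_single_true]
          simp only [hx, hy, and_self, if_true]
          module)
      rw [map_sub, h0, sub_eq_iff_eq_add] at h1
      rw [h1]
      have e : (t : ℂ) * -(γ : ℂ) = -((γ : ℂ) * t) := by ring
      push_cast
      rw [e, mul_zero, Complex.exp_zero]
      module
  · intro hxy
    have h := evol_apply_eigenvector (lindbladian γ (jumpOp C)) t
      (Matrix.single (x, true) (y, true) 1) (-γ / 2) (by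
        rw [lindbladian_single_true]
        cases hx : C x <;> cases hy : C y
        · exact absurd (hx.trans hy.symm) hxy
        · simp only [Bool.true_eq_false, and_false, if_true, if_false]
          module
        · simp only [Bool.true_eq_false, false_and, if_true, if_false]
          module
        · exact absurd (hx.trans hy.symm) hxy)
    rw [h]
    have e : (t : ℂ) * (-(γ : ℂ) / 2) = -((γ : ℂ) * t / 2) := by ring
    push_cast
    rw [e]
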